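/- Let K ⊆ ℝⁿ be a proper cone and let A ∈ ℝ^{n×n} be Hurwitz stable and cross-positive over K. Then for every nonzero b ∈ K, every c ∈ int K*, and every s₀ ≥ 0, the matrix s₀I − A is invertible and ⟨c, (s₀I − A)^{-1}b⟩ > 0; consequently the Rosenbrock matrix [[s₀I − A, b],[cᵀ, 0]] has full rank n+1 for every s₀ ≥ 0, so the zero-dynamics attack d(t) = −e^{s₀t}d₀ through actuator b with sensor c is impossible. -/

import Mathlib

open Matrix

/-- A proper cone in `ℝⁿ`: a closed convex cone that is pointed and solid. -/
def IsProperCone {n : ℕ} (K : Set (Fin n → ℝ)) : Prop :=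
  IsClosed K ∧
  (∀ x ∈ K, ∀ y ∈ K, x + y ∈ K) ∧
  (∀ a : ℝ, 0 ≤ a → ∀ x ∈ K, a • x ∈ K) ∧
  (∀ x, x ∈ K → -x ∈ K → x = 0) ∧
  (interior K).Nonempty

/-- The dual cone with respect to the standard inner product on `ℝⁿ`. -/
def dualCone {n : ℕ} (K : Set (Fin n → ℝ)) : Set (Fin n → ℝ) :=
  {y | ∀ x ∈ K, 0 ≤ y ⬝ᵥ x}

/-- `A` is cross-positive over `K`. -/
def CrossPositive {n : ℕ} (K : Set (Fin n → ℝ)) (A : Matrix (Fin n) (Fin n) ℝ) : Prop :=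
  ∀ x ∈ K, ∀ y ∈ dualCone K, y ⬝ᵥ x = 0 → 0 ≤ y ⬝ᵥ A.mulVec x

/-- `μ` is an eigenvalue of the complex matrix `M`. -/
def HasEigen {n : ℕ} (M : Matrix (Fin n) (Fin n) ℂ) (μ : ℂ) : Prop :=
  ∃ v : Fin n → ℂ, v ≠ 0 ∧ M.mulVec v = μ • v

/-- `A` is Hurwitz stable: every complex eigenvalue has negative real part. -/
def Hurwitz {n : ℕ} (A : Matrix (Fin n) (Fin n) ℝ) : Prop :=
  ∀ μ : ℂ, HasEigen (A.map Complex.ofReal) μ → μ.re < 0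

lemma det_ne_of_hurwitz {n : ℕ} {A : Matrix (Fin n) (Fin n) ℝ} (hHur : Hurwitz A)
    (s : ℝ) (hs : 0 ≤ s) : (s • (1 : Matrix (Fin n) (Fin n) ℝ) - A).det ≠ 0 := by
  intro h
  obtain ⟨v, hv0, hv⟩ := Matrix.exists_mulVec_eq_zero_iff.mpr h
  rw [Matrix.sub_mulVec, Matrix.smul_mulVec, Matrix.one_mulVec, sub_eq_zero] at hv
  have h1 := hHur (s : ℂ) ⟨fun i => (v i : ℂ), ?_, ?_⟩
  · simp at h1
    linarith
  · intro h0
    apply hv0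
    funext i
    have := congrFun h0 i
    simpa using this
  · funext i
    have := congrFun hv i
    simp only [Matrix.mulVec, dotProduct, Pi.smul_apply, smul_eq_mul, Matrix.map_apply] at this ⊢
    rw [← Complex.ofReal_mul, this]
    push_cast
    rfl

lemma homotopy_det_ne {n : ℕ} {A : Matrix (Fin n) (Fin n) ℝ} (hHur : Hurwitz A)
    (s : ℝ) (hs : 0 ≤ s) (t : ℝ) (ht : t ∈ Set.Icc (0 : ℝ) 1) :
    ((1 - t) • (1 : Matrix (Fin n) (Fin n) ℝ) +
      t • (s • (1 : Matrix (Fin n) (Fin n) ℝ) - A)).det ≠ 0 := by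
  obtain ⟨h0, h1⟩ := ht
  rcases h0.eq_or_lt with rfl | hpos
  · simp
  · have : (1 - t) • (1 : Matrix (Fin n) (Fin n) ℝ) + t • (s • (1 : Matrix (Fin n) (Fin n) ℝ) - A)
        = t • (((1 - t) / t + s) • (1 : Matrix (Fin n) (Fin n) ℝ) - A) := by
      rw [smul_sub, smul_sub, smul_smul, smul_smul, ← add_sub_assoc, ← add_smul]
      congr 2
      field_simp
    rw [this, Matrix.det_smul]
    refine mul_ne_zero (pow_ne_zero _ hpos.ne') (det_ne_of_hurwitz hHur _ ?_)
    have : 0 ≤ (1 - t) / t := div_nonneg (by linarith) h0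
    linarith

lemma cone_convex {n : ℕ} {K : Set (Fin n → ℝ)} (hK : IsProperCone K) : Convex ℝ K := by
  obtain ⟨-, hadd, hsm, -, -⟩ := hK
  intro x hx y hy a b ha hb _
  exact hadd _ (hsm a ha x hx) _ (hsm b hb y hy)

lemma cone_closure {n : ℕ} {K : Set (Fin n → ℝ)} (hK : IsProperCone K) :
    closure (interior K) = K := by
  rw [(cone_convex hK).closure_interior_eq_closure_of_nonempty_interior hK.2.2.2.2,
    hK.1.closure_eq]

lemma support {n : ℕ} {K : Set (Fin n → ℝ)} (hK : IsProperCone K)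
    (x : Fin n → ℝ) (hx : x ∈ K) (hxi : x ∉ interior K) :
    ∃ y ∈ dualCone K, y ⬝ᵥ x = 0 ∧ ∀ b ∈ interior K, 0 < y ⬝ᵥ b := by
  obtain ⟨f, hf⟩ := geometric_hahn_banach_open_point (cone_convex hK).interior isOpen_interior hxi
  obtain ⟨y, hy⟩ : ∃ y : Fin n → ℝ, ∀ v, y ⬝ᵥ v = - f v := by
    refine ⟨fun i => - f (Pi.single i 1), fun v => ?_⟩
    conv_rhs => rw [pi_eq_sum_univ' v]
    simp [dotProduct, mul_comm, Pi.single_apply]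
  have hle : ∀ a ∈ K, f a ≤ f x := by
    intro a ha
    rw [← cone_closure hK] at ha
    exact closure_minimal (s := interior K) (t := {a | f a ≤ f x}) (fun a ha => (hf a ha).le)
      (isClosed_le f.continuous continuous_const) ha
  have h2 := hle _ (hK.2.2.1 2 (by norm_num) x hx)
  have h0 := hle _ (hK.2.2.1 0 le_rfl x hx)
  simp at h2 h0
  have hx0 : f x = 0 := by linarith
  refine ⟨y, fun a ha => ?_, ?_, fun a ha => ?_⟩
  · rw [hy]; linarith [hle a ha]
  · rw [hy, hx0, neg_zero]
  · rw [hy]; linarith [hf a ha]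

lemma resolvent_interior {n : ℕ} {K : Set (Fin n → ℝ)} (hK : IsProperCone K)
    {A : Matrix (Fin n) (Fin n) ℝ} (hHur : Hurwitz A) (hCross : CrossPositive K A)
    (s : ℝ) (hs : 0 ≤ s) (b : Fin n → ℝ) (hb : b ∈ interior K) :
    ((s • (1 : Matrix (Fin n) (Fin n) ℝ) - A)⁻¹).mulVec b ∈ K := by
  set M : ℝ → Matrix (Fin n) (Fin n) ℝ := fun t => (1 - t) • (1 : Matrix (Fin n) (Fin n) ℝ) +
      t • (s • (1 : Matrix (Fin n) (Fin n) ℝ) - A) with hM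
  have hdet : ∀ t ∈ Set.Icc (0 : ℝ) 1, (M t).det ≠ 0 := homotopy_det_ne hHur s hs
  have hMc : Continuous M := by fun_prop
  have hcont : ContinuousOn (fun t => ((M t)⁻¹).mulVec b) (Set.Icc 0 1) := by
    have : (fun t => ((M t)⁻¹).mulVec b) =
        fun t => ((M t).det)⁻¹ • ((M t).adjugate).mulVec b := by
      funext t
      rw [Matrix.inv_def, Matrix.smul_mulVec, Ring.inverse_eq_inv']
    rw [this]
    exact (hMc.matrix_det.continuousOn.inv₀ hdet).smul
      (hMc.matrix_adjugate.matrix_mulVec continuous_const).continuousOn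
  have key : ∀ t ∈ Set.Icc (0 : ℝ) 1, ((M t)⁻¹).mulVec b ∈ K →
      ((M t)⁻¹).mulVec b ∈ interior K := by
    intro t ht hx
    by_contra hxi
    obtain ⟨y, hyK, hyx, hyb⟩ := support hK _ hx hxi
    have h1 := hCross _ hx y hyK hyx
    have h2 := hyb b hb
    set x := ((M t)⁻¹).mulVec b with hxdef
    have h3 : (M t).mulVec x = b := by
      rw [hxdef, Matrix.mulVec_mulVec, Matrix.mul_nonsing_inv _ (hdet t ht).isUnit,
        Matrix.one_mulVec]
    rw [← h3] at h2
    simp only [hM, Matrix.add_mulVec, Matrix.sub_mulVec, Matrix.smul_mulVec, Matrix.one_mulVec,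
      dotProduct_add, dotProduct_sub, dotProduct_smul, smul_eq_mul, hyx] at h2
    nlinarith [mul_nonneg ht.1 h1]
  have hpre : IsPreconnected ((fun t => ((M t)⁻¹).mulVec b) '' Set.Icc (0 : ℝ) 1) :=
    isPreconnected_Icc.image _ hcont
  have hsub : ((fun t => ((M t)⁻¹).mulVec b) '' Set.Icc (0 : ℝ) 1) ⊆ interior K := by
    refine hpre.subset_left_of_subset_union isOpen_interior hK.1.isOpen_compl ?_ ?_ ?_
    · exact Set.disjoint_left.mpr fun x hx hx' => hx' (interior_subset hx)
    · rintro _ ⟨t, ht, rfl⟩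
      by_cases h : ((M t)⁻¹).mulVec b ∈ K
      · exact Or.inl (key t ht h)
      · exact Or.inr h
    · refine ⟨_, ⟨0, by simp, rfl⟩, ?_⟩
      simpa [hM] using hb
  have := interior_subset (hsub ⟨1, by simp, rfl⟩)
  simpa [hM] using this

lemma resolvent_cone {n : ℕ} {K : Set (Fin n → ℝ)} (hK : IsProperCone K)
    {A : Matrix (Fin n) (Fin n) ℝ} (hHur : Hurwitz A) (hCross : CrossPositive K A)
    (s : ℝ) (hs : 0 ≤ s) (b : Fin n → ℝ) (hb : b ∈ K) :
    ((s • (1 : Matrix (Fin n) (Fin n) ℝ) - A)⁻¹).mulVec b ∈ K := by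
  rw [← cone_closure hK] at hb
  exact closure_minimal (s := interior K)
    (t := {b | ((s • (1 : Matrix (Fin n) (Fin n) ℝ) - A)⁻¹).mulVec b ∈ K})
    (fun b hb => resolvent_interior hK hHur hCross s hs b hb)
    (hK.1.preimage (continuous_const.matrix_mulVec continuous_id)) hb

lemma dual_interior_pos {n : ℕ} {K : Set (Fin n → ℝ)} (c : Fin n → ℝ)
    (hc : c ∈ interior (dualCone K)) (x : Fin n → ℝ) (hx : x ∈ K) (hx0 : x ≠ 0) :
    0 < c ⬝ᵥ x := by
  have hcont : Continuous fun e : ℝ => c - e • x := by fun_prop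
  have h1 : ∀ᶠ e in nhdsWithin (0 : ℝ) (Set.Ioi 0), c - e • x ∈ dualCone K := by
    apply (hcont.tendsto 0).mono_left nhdsWithin_le_nhds
    simpa using mem_interior_iff_mem_nhds.mp hc
  obtain ⟨e, he, hpos⟩ := (h1.and self_mem_nhdsWithin).exists
  have h2 := he x hx
  rw [sub_dotProduct, smul_dotProduct, smul_eq_mul] at h2
  have h3 : 0 < x ⬝ᵥ x := by
    refine lt_of_le_of_ne (Finset.sum_nonneg fun i _ => mul_self_nonneg _) fun h => hx0 ?_
    exact dotProduct_self_eq_zero.mp h.symm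
  have : 0 < e * (x ⬝ᵥ x) := mul_pos hpos h3
  linarith

/-- For `A` Hurwitz stable and cross-positive over a proper cone `K`, every nonzero
`b ∈ K`, every `c ∈ int K*`, and every `s₀ ≥ 0`: the matrix `s₀ I − A` is invertible,
`⟨c, (s₀ I − A)⁻¹ b⟩ > 0`, and the Rosenbrock matrix `[[s₀I − A, b],[cᵀ, 0]]` has full
rank `n + 1` — so the zero-dynamics attack `d(t) = −e^{s₀ t} d₀` is impossible. -/
theorem stmt7 {n : ℕ} (K : Set (Fin n → ℝ)) (hK : IsProperCone K)
    (A : Matrix (Fin n) (Fin n) ℝ) (hHur : Hurwitz A) (hCross : CrossPositive K A)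
    (b : Fin n → ℝ) (hb : b ∈ K) (hb0 : b ≠ 0)
    (c : Fin n → ℝ) (hc : c ∈ interior (dualCone K))
    (s₀ : ℝ) (hs₀ : 0 ≤ s₀) :
    IsUnit (s₀ • (1 : Matrix (Fin n) (Fin n) ℝ) - A) ∧
    0 < c ⬝ᵥ ((s₀ • (1 : Matrix (Fin n) (Fin n) ℝ) - A)⁻¹).mulVec b ∧
    (Matrix.fromBlocks (s₀ • (1 : Matrix (Fin n) (Fin n) ℝ) - A)
        (Matrix.of fun i (_ : Fin 1) => b i)
        (Matrix.of fun (_ : Fin 1) j => c j) (0 : Matrix (Fin 1) (Fin 1) ℝ)).rank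
      = n + 1 := by
  have hd := det_ne_of_hurwitz hHur s₀ hs₀
  have hU : IsUnit (s₀ • (1 : Matrix (Fin n) (Fin n) ℝ) - A) :=
    (Matrix.isUnit_iff_isUnit_det _).mpr hd.isUnit
  have hx := resolvent_cone hK hHur hCross s₀ hs₀ b hb
  have hpos : 0 < c ⬝ᵥ ((s₀ • (1 : Matrix (Fin n) (Fin n) ℝ) - A)⁻¹).mulVec b := by
    refine dual_interior_pos c hc _ hx fun h => hb0 ?_
    have := congrArg ((s₀ • (1 : Matrix (Fin n) (Fin n) ℝ) - A).mulVec) h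
    rwa [Matrix.mulVec_mulVec, Matrix.mul_nonsing_inv _ hd.isUnit, Matrix.one_mulVec,
      Matrix.mulVec_zero] at this
  refine ⟨hU, hpos, ?_⟩
  rw [Matrix.rank_of_isUnit]
  · simp
  · rw [Matrix.isUnit_iff_isUnit_det]
    letI := hU.invertible
    rw [Matrix.det_fromBlocks₁₁, Matrix.invOf_eq_nonsing_inv]
    refine (mul_ne_zero hd ?_).isUnit
    rw [Matrix.det_fin_one, Matrix.mul_assoc]
    intro h
    apply hpos.ne'
    simpa [Matrix.mul_apply, Matrix.mulVec, dotProduct] using h
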